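/- Let h ≥ 1 be an integer, u₁ ∈ 𝔽_h, and v₀ ∈ 𝔽_h with v₀ ≥ 0 on Ω. Then the unique minimizer v₁ of J_h(u₁, ·) over { v ∈ 𝔽_h : v ≤ v₀ on Ω } satisfies 0 ≤ v₁ ≤ 1 on Ω. -/

import Mathlib

open MeasureTheory Filter
open scoped Classical
open scoped RealInnerProductSpace

noncomputable section

abbrev E2 : Type := EuclideanSpace ℝ (Fin 2)

/-- The point `(a, b) ∈ ℝ²`. -/
def vtx (a b : ℝ) : E2 := (WithLp.equiv 2 (Fin 2 → ℝ)).symm ![a, b]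

/-- The open unit square `Ω = (0,1)²`. -/
def Omega : Set E2 := {x | x 0 ∈ Set.Ioo (0:ℝ) 1 ∧ x 1 ∈ Set.Ioo (0:ℝ) 1}

/-- The closed unit square `Ω̄ = [0,1]²`. -/
def OmegaCl : Set E2 := {x | x 0 ∈ Set.Icc (0:ℝ) 1 ∧ x 1 ∈ Set.Icc (0:ℝ) 1}

/-- The boundary `∂Ω = Ω̄ \ Ω`. -/
def OmegaBd : Set E2 := OmegaCl \ Omega

/-- Lower-left triangle `K⁺_{k,j}` of the uniform triangulation `𝒯_h`. -/
def Kplus (h k j : ℕ) : Set E2 :=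
  {x | ((k:ℝ)-1)/h ≤ x 0 ∧ x 0 ≤ (k:ℝ)/h ∧ ((j:ℝ)-1)/h ≤ x 1 ∧
        x 1 ≤ ((j:ℝ)-1)/h + ((k:ℝ)/h - x 0)}

/-- Upper-right triangle `K⁻_{k,j}` of the uniform triangulation `𝒯_h`. -/
def Kminus (h k j : ℕ) : Set E2 :=
  {x | ((k:ℝ)-1)/h ≤ x 0 ∧ x 0 ≤ (k:ℝ)/h ∧ (j:ℝ)/h + (((k:ℝ)-1)/h - x 0) ≤ x 1 ∧
        x 1 ≤ (j:ℝ)/h}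

/-- `u` is affine on the set `S`. -/
def IsAffineOn (u : E2 → ℝ) (S : Set E2) : Prop :=
  ∃ (b : E2) (c : ℝ), ∀ x ∈ S, u x = ⟪b, x⟫ + c

/-- Membership in the finite element space `𝔽_h`: continuous on `Ω̄` and affine on every
triangle of the uniform triangulation `𝒯_h`. -/
def MemF (h : ℕ) (u : E2 → ℝ) : Prop :=
  ContinuousOn u OmegaCl ∧
  ∀ k j : ℕ, 1 ≤ k → k ≤ h → 1 ≤ j → j ≤ h →
    IsAffineOn u (Kplus h k j) ∧ IsAffineOn u (Kminus h k j)

/-- The set `Δ_h` of vertices of the triangulation `𝒯_h`. -/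
def Delta (h : ℕ) : Set E2 :=
  {x | ∃ k j : ℕ, k ≤ h ∧ j ≤ h ∧ x = vtx ((k:ℝ)/h) ((j:ℝ)/h)}

/-- The vertex `(k/h, j/h)` of `𝒯_h`. -/
def vertexPt (h k j : ℕ) : E2 := vtx ((k:ℝ)/h) ((j:ℝ)/h)

/-- `p` is the Lagrange interpolant of `f` on `𝒯_h`: `p ∈ 𝔽_h` and `p = f` on `Δ_h`. -/
def Interpolates (h : ℕ) (f p : E2 → ℝ) : Prop :=
  MemF h p ∧ ∀ x ∈ Delta h, p x = f x

/-- The Lagrange interpolation operator `P_h` (a choice of interpolant; it is unique on `Ω̄`). -/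

noncomputable def Ph (h : ℕ) (f : E2 → ℝ) : E2 → ℝ :=
  if hf : ∃ p, Interpolates h f p then hf.choose else 0

/-- Almost-everywhere defined gradient. -/
noncomputable def grad (u : E2 → ℝ) (x : E2) : E2 := gradient u x

/-- The squared `H¹(Ω)` norm `‖u‖²_{H¹} = ∫_Ω (u² + |∇u|²)`. -/
noncomputable def H1normSq (u : E2 → ℝ) : ℝ :=
  ∫ x in Omega, ((u x)^2 + ‖grad u x‖^2)

/-- The discrete phase-field energy `J_h`. -/
noncomputable def Jh (h : ℕ) (η : ℝ) (u v : E2 → ℝ) : ℝ :=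
  (1/2) * (∫ x in Omega, ((Ph h (fun y => (v y)^2) x + η) * ‖grad u x‖^2))
  + (1/2) * (∫ x in Omega, ‖grad v x‖^2)
  + (1/2) * (∫ x in Omega, Ph h (fun y => (1 - v y)^2) x)

/-- `u ∈ 𝔄_h(w)`: `u ∈ 𝔽_h` and `u = w` on `∂Ω`. -/
def MemA (h : ℕ) (w u : E2 → ℝ) : Prop :=
  MemF h u ∧ ∀ x ∈ OmegaBd, u x = w x

/-- Convergence in `𝔽_h`, i.e. with respect to the `H¹(Ω)` norm. -/
def TendstoF (u : ℕ → E2 → ℝ) (ub : E2 → ℝ) : Prop :=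
  Tendsto (fun j => H1normSq (fun y => u j y - ub y)) atTop (nhds 0)

/-- `u` minimizes `J_h(·, v)` over `𝔄_h(w)`. -/
def IsMinU (h : ℕ) (η : ℝ) (w v u : E2 → ℝ) : Prop :=
  MemA h w u ∧ ∀ u', MemA h w u' → Jh h η u v ≤ Jh h η u' v

/-- `v` minimizes `J_h(u, ·)` over `{v ∈ 𝔽_h : v ≤ vprev on Ω}`. -/
def IsMinV (h : ℕ) (η : ℝ) (u vprev v : E2 → ℝ) : Prop :=
  (MemF h v ∧ ∀ x ∈ Omega, v x ≤ vprev x) ∧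
  ∀ v', MemF h v' → (∀ x ∈ Omega, v' x ≤ vprev x) → Jh h η u v ≤ Jh h η u v'

end

lemma inner_E2 (b x : E2) : ⟪b, x⟫ = b 0 * x 0 + b 1 * x 1 := by
  simp [PiLp.inner_apply, Fin.sum_univ_two, mul_comm]

@[simp] lemma vtx_zero (a b : ℝ) : vtx a b 0 = a := rfl

@[simp] lemma vtx_one (a b : ℝ) : vtx a b 1 = b := rfl

lemma continuous_coord (i : Fin 2) : Continuous fun x : E2 => x i := by fun_prop

lemma isAffineOn_iff {u : E2 → ℝ} {S : Set E2} :
    IsAffineOn u S ↔ ∃ α β γ : ℝ, ∀ x ∈ S, u x = α * x 0 + β * x 1 + γ := by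
  constructor
  · rintro ⟨b, c, hb⟩
    exact ⟨b 0, b 1, c, fun x hx => by rw [hb x hx, inner_E2]⟩
  · rintro ⟨α, β, γ, hu⟩
    exact ⟨vtx α β, γ, fun x hx => by rw [hu x hx, inner_E2, vtx_zero, vtx_one]⟩

/-! ### Existence of the Lagrange interpolant -/

/-- The reference hat function of the uniform triangulation. -/
def hat (s t : ℝ) : ℝ := max 0 (1 - max (max |s| |t|) |s + t|)

lemma hat_neg (s t : ℝ) : hat (-s) (-t) = hat s t := by
  have : -s + -t = -(s + t) := by ring
  simp only [hat, this, abs_neg]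

lemma hat_eq_zero {s t : ℝ} (hst : 1 ≤ |s| ∨ 1 ≤ |t| ∨ 1 ≤ |s + t|) : hat s t = 0 := by
  apply max_eq_left
  have : 1 ≤ max (max |s| |t|) |s + t| := by
    simpa only [le_max_iff, or_assoc] using hst
  linarith

lemma hat_eq {s t r : ℝ} (hr : r ≤ 1) (hs : |s| ≤ r) (ht : |t| ≤ r) (hst : |s + t| ≤ r)
    (he : r = |s| ∨ r = |t| ∨ r = |s + t|) : hat s t = 1 - r := by
  have : max (max |s| |t|) |s + t| = r := by
    refine le_antisymm (max_le (max_le hs ht) hst) ?_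
    rcases he with he | he | he <;> simp [he]
  rw [hat, this]
  exact max_eq_right (by linarith)

lemma hat_affine_plus (m n : ℤ) : ∃ α β γ : ℝ, ∀ s t : ℝ, (m : ℝ) ≤ s → (n : ℝ) ≤ t →
    s + t ≤ m + n + 1 → hat s t = α * s + β * t + γ := by
  by_cases hm : 1 ≤ m ∨ m ≤ -2 ∨ 1 ≤ n ∨ n ≤ -2 ∨ (m = -1 ∧ n = -1)
  · refine ⟨0, 0, 0, fun s t hs ht hst => ?_⟩
    rw [hat_eq_zero]
    · ring
    · rcases hm with hm | hm | hm | hm | ⟨rfl, rfl⟩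
      · have : (1 : ℝ) ≤ m := by exact_mod_cast hm
        exact Or.inl (le_abs.2 (Or.inl (by linarith)))
      · have : (m : ℝ) ≤ -2 := by exact_mod_cast hm
        exact Or.inl (le_abs.2 (Or.inr (by linarith)))
      · have : (1 : ℝ) ≤ n := by exact_mod_cast hm
        exact Or.inr (Or.inl (le_abs.2 (Or.inl (by linarith))))
      · have : (n : ℝ) ≤ -2 := by exact_mod_cast hm
        exact Or.inr (Or.inl (le_abs.2 (Or.inr (by linarith))))
      · push_cast at hst
        exact Or.inr (Or.inr (le_abs.2 (Or.inr (by linarith))))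
  · obtain ⟨rfl, rfl⟩ | ⟨rfl, rfl⟩ | ⟨rfl, rfl⟩ :
        (m = 0 ∧ n = 0) ∨ (m = -1 ∧ n = 0) ∨ (m = 0 ∧ n = -1) := by omega
    · refine ⟨-1, -1, 1, fun s t hs ht hst => ?_⟩
      push_cast at hs ht hst
      rw [hat_eq (r := s + t) (by linarith) (abs_le.2 ⟨by linarith, by linarith⟩)
        (abs_le.2 ⟨by linarith, by linarith⟩) (abs_le.2 ⟨by linarith, by linarith⟩)
        (Or.inr (Or.inr (abs_of_nonneg (by linarith)).symm))]
      ring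
    · refine ⟨1, 0, 1, fun s t hs ht hst => ?_⟩
      push_cast at hs ht hst
      rw [hat_eq (r := -s) (by linarith) (abs_le.2 ⟨by linarith, by linarith⟩)
        (abs_le.2 ⟨by linarith, by linarith⟩) (abs_le.2 ⟨by linarith, by linarith⟩)
        (Or.inl (abs_of_nonpos (by linarith)).symm)]
      ring
    · refine ⟨0, 1, 1, fun s t hs ht hst => ?_⟩
      push_cast at hs ht hst
      rw [hat_eq (r := -t) (by linarith) (abs_le.2 ⟨by linarith, by linarith⟩)
        (abs_le.2 ⟨by linarith, by linarith⟩) (abs_le.2 ⟨by linarith, by linarith⟩)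
        (Or.inr (Or.inl (abs_of_nonpos (by linarith)).symm))]
      ring

lemma hat_affine_minus (m n : ℤ) : ∃ α β γ : ℝ, ∀ s t : ℝ, s ≤ m → t ≤ n →
    m + n - 1 ≤ s + t → hat s t = α * s + β * t + γ := by
  obtain ⟨α, β, γ, H⟩ := hat_affine_plus (-m) (-n)
  refine ⟨-α, -β, γ, fun s t hs ht hst => ?_⟩
  rw [← hat_neg, H (-s) (-t) (by push_cast; linarith) (by push_cast; linarith)
    (by push_cast; linarith)]
  ring

lemma hat_intCast (m n : ℤ) : hat m n = if m = 0 ∧ n = 0 then 1 else 0 := by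
  split_ifs with hmn
  · obtain ⟨rfl, rfl⟩ := hmn
    simp [hat]
  · apply hat_eq_zero
    by_cases hm : m = 0
    · right; left
      exact_mod_cast Int.one_le_abs fun hn => hmn ⟨hm, hn⟩
    · left
      exact_mod_cast Int.one_le_abs hm

lemma continuous_hat : Continuous fun p : ℝ × ℝ => hat p.1 p.2 := by
  unfold hat
  fun_prop

lemma IsAffineOn.sum {ι : Type*} (s : Finset ι) {u : ι → E2 → ℝ} {S : Set E2}
    (hu : ∀ i ∈ s, IsAffineOn (u i) S) : IsAffineOn (fun x => ∑ i ∈ s, u i x) S := by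
  choose! b c hbc using hu
  refine ⟨∑ i ∈ s, b i, ∑ i ∈ s, c i, fun x hx => ?_⟩
  rw [sum_inner, ← Finset.sum_add_distrib]
  exact Finset.sum_congr rfl fun i hi => hbc i hi x hx

lemma IsAffineOn.const_mul {u : E2 → ℝ} {S : Set E2} (a : ℝ) (hu : IsAffineOn u S) :
    IsAffineOn (fun x => a * u x) S := by
  obtain ⟨b, c, hbc⟩ := hu
  refine ⟨a • b, a * c, fun x hx => ?_⟩
  simp only [hbc x hx, real_inner_smul_left]
  ring

lemma mem_Kplus {h : ℕ} (hh : 1 ≤ h) {k j : ℕ} {x : E2} : x ∈ Kplus h k j ↔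
    (k : ℝ) - 1 ≤ h * x 0 ∧ (j : ℝ) - 1 ≤ h * x 1 ∧ h * x 0 + h * x 1 ≤ k + j - 1 := by
  have h0 : (0 : ℝ) < h := by exact_mod_cast hh
  have e : ((j : ℝ) - 1) / h + (k / h - x 0) = ((j : ℝ) - 1 + k - h * x 0) / h := by
    field_simp
    ring
  simp only [Kplus, Set.mem_ofPred_eq, e, div_le_iff₀ h0, le_div_iff₀ h0, mul_comm _ (h : ℝ)]
  constructor
  · rintro ⟨h1, -, h3, h4⟩
    exact ⟨h1, h3, by linarith⟩
  · rintro ⟨h1, h2, h3⟩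
    exact ⟨h1, by linarith, h2, by linarith⟩

lemma mem_Kminus {h : ℕ} (hh : 1 ≤ h) {k j : ℕ} {x : E2} : x ∈ Kminus h k j ↔
    h * x 0 ≤ k ∧ h * x 1 ≤ j ∧ (k : ℝ) + j - 1 ≤ h * x 0 + h * x 1 := by
  have h0 : (0 : ℝ) < h := by exact_mod_cast hh
  have e : (j : ℝ) / h + (((k : ℝ) - 1) / h - x 0) = ((j : ℝ) - 1 + k - h * x 0) / h := by
    field_simp
    ring
  simp only [Kminus, Set.mem_ofPred_eq, e, div_le_iff₀ h0, le_div_iff₀ h0, mul_comm _ (h : ℝ)]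
  constructor
  · rintro ⟨-, h2, h3, h4⟩
    exact ⟨h2, h4, by linarith⟩
  · rintro ⟨h1, h2, h3⟩
    exact ⟨by linarith, h1, by linarith, h2⟩

lemma memF_hat {h : ℕ} (hh : 1 ≤ h) (k j : ℕ) :
    MemF h fun x => hat (h * x 0 - k) (h * x 1 - j) := by
  refine ⟨?_, fun k' j' _ _ _ _ => ⟨?_, ?_⟩⟩
  · refine (continuous_hat.comp (?_ : Continuous fun x : E2 =>
      ((h * x 0 - k : ℝ), (h * x 1 - j : ℝ)))).continuousOn
    fun_prop
  · obtain ⟨α, β, γ, H⟩ := hat_affine_plus ((k' : ℤ) - 1 - k) ((j' : ℤ) - 1 - j)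
    refine isAffineOn_iff.2 ⟨α * h, β * h, γ - α * k - β * j, fun x hx => ?_⟩
    obtain ⟨h1, h2, h3⟩ := (mem_Kplus hh).1 hx
    rw [H _ _ (by push_cast; linarith) (by push_cast; linarith) (by push_cast; linarith)]
    ring
  · obtain ⟨α, β, γ, H⟩ := hat_affine_minus ((k' : ℤ) - k) ((j' : ℤ) - j)
    refine isAffineOn_iff.2 ⟨α * h, β * h, γ - α * k - β * j, fun x hx => ?_⟩
    obtain ⟨h1, h2, h3⟩ := (mem_Kminus hh).1 hx
    rw [H _ _ (by push_cast; linarith) (by push_cast; linarith) (by push_cast; linarith)]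
    ring

lemma MemF.sum {h : ℕ} {ι : Type*} (s : Finset ι) {u : ι → E2 → ℝ}
    (hu : ∀ i ∈ s, MemF h (u i)) : MemF h fun x => ∑ i ∈ s, u i x :=
  ⟨continuousOn_finsetSum s fun i hi => (hu i hi).1, fun k j h1 h2 h3 h4 =>
    ⟨IsAffineOn.sum s fun i hi => ((hu i hi).2 k j h1 h2 h3 h4).1,
      IsAffineOn.sum s fun i hi => ((hu i hi).2 k j h1 h2 h3 h4).2⟩⟩

lemma MemF.const_mul {h : ℕ} {u : E2 → ℝ} (a : ℝ) (hu : MemF h u) :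
    MemF h fun x => a * u x :=
  ⟨hu.1.const_mul a, fun k j h1 h2 h3 h4 =>
    ⟨(hu.2 k j h1 h2 h3 h4).1.const_mul a, (hu.2 k j h1 h2 h3 h4).2.const_mul a⟩⟩

lemma memF_const (h : ℕ) (a : ℝ) : MemF h fun _ => a :=
  ⟨continuousOn_const, fun _ _ _ _ _ _ =>
    ⟨⟨0, a, fun _ _ => by simp⟩, ⟨0, a, fun _ _ => by simp⟩⟩⟩

lemma exists_interpolates {h : ℕ} (hh : 1 ≤ h) (f : E2 → ℝ) : ∃ p, Interpolates h f p := by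
  have h0 : (h : ℝ) ≠ 0 := by exact_mod_cast (by omega : h ≠ 0)
  refine ⟨fun x => ∑ i ∈ Finset.range (h + 1) ×ˢ Finset.range (h + 1),
    f (vertexPt h i.1 i.2) * hat (h * x 0 - i.1) (h * x 1 - i.2),
    MemF.sum _ fun i _ => (memF_hat hh i.1 i.2).const_mul _, ?_⟩
  rintro x ⟨k, j, hk, hj, rfl⟩
  beta_reduce
  rw [Finset.sum_eq_single (k, j)]
  · simp [vertexPt, mul_div_cancel₀ _ h0, hat]
  · rintro ⟨k', j'⟩ - hne
    have := hat_intCast ((k : ℤ) - k') ((j : ℤ) - j')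
    rw [if_neg] at this
    · push_cast at this
      simp [mul_div_cancel₀ _ h0, this]
    · rintro ⟨h1, h2⟩
      exact hne (Prod.ext (by simp only; omega) (by simp only; omega))
  · intro hn
    simp at hn
    omega

lemma interpolates_Ph {h : ℕ} (hh : 1 ≤ h) (f : E2 → ℝ) : Interpolates h f (Ph h f) := by
  rw [Ph, dif_pos (exists_interpolates hh f)]
  exact (exists_interpolates hh f).choose_spec

/-! ### The cells of the triangulation -/

/-- Indices of the triangles: `(k, j, true)` is the triangle `K⁺` of the square with lower left
corner `(k/h, j/h)`, and `(k, j, false)` is its triangle `K⁻`. -/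
abbrev Cell (h : ℕ) : Type := Fin h × Fin h × Bool

namespace Cell

variable {h : ℕ}

/-- The closed triangle with index `c`. -/
def tri (c : Cell h) : Set E2 :=
  if c.2.2 then Kplus h (c.1 + 1) (c.2.1 + 1) else Kminus h (c.1 + 1) (c.2.1 + 1)

/-- `1` on the triangles `K⁺` and `-1` on the triangles `K⁻`. -/
def sgn (c : Cell h) : ℝ := if c.2.2 then 1 else -1

/-- First coordinate, in units of `1/h`, of the right-angled vertex. -/
def m (c : Cell h) : ℝ := if c.2.2 then c.1 else c.1 + 1

/-- Second coordinate, in units of `1/h`, of the right-angled vertex. -/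
def n (c : Cell h) : ℝ := if c.2.2 then c.2.1 else c.2.1 + 1

/-- The right-angled vertex. -/
noncomputable def p₀ (c : Cell h) : E2 := vtx (c.m / h) (c.n / h)

/-- The vertex sharing the horizontal edge with the right-angled one. -/
noncomputable def p₁ (c : Cell h) : E2 := vtx ((c.m + c.sgn) / h) (c.n / h)

/-- The vertex sharing the vertical edge with the right-angled one. -/
noncomputable def p₂ (c : Cell h) : E2 := vtx (c.m / h) ((c.n + c.sgn) / h)

lemma sgn_mul_self (c : Cell h) : c.sgn * c.sgn = 1 := by
  unfold sgn
  split_ifs <;> norm_num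

lemma mem_tri (hh : 1 ≤ h) {c : Cell h} {x : E2} : x ∈ c.tri ↔
    0 ≤ c.sgn * (h * x 0 - c.m) ∧ 0 ≤ c.sgn * (h * x 1 - c.n) ∧
      c.sgn * (h * x 0 - c.m) + c.sgn * (h * x 1 - c.n) ≤ 1 := by
  obtain ⟨k, j, b⟩ := c
  cases b
  · simp only [tri, sgn, m, n, Bool.false_eq_true, if_false, mem_Kminus hh]
    push_cast
    constructor <;> rintro ⟨h1, h2, h3⟩ <;> refine ⟨?_, ?_, ?_⟩ <;> linarith
  · simp only [tri, sgn, m, n, if_true, mem_Kplus hh]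
    push_cast
    constructor <;> rintro ⟨h1, h2, h3⟩ <;> refine ⟨?_, ?_, ?_⟩ <;> linarith

lemma p₀_mem_Delta (c : Cell h) : c.p₀ ∈ Delta h := by
  obtain ⟨k, j, b⟩ := c
  cases b
  · exact ⟨k + 1, j + 1, by omega, by omega, by simp [p₀, m, n]⟩
  · exact ⟨k, j, by omega, by omega, by simp [p₀, m, n]⟩

lemma p₁_mem_Delta (c : Cell h) : c.p₁ ∈ Delta h := by
  obtain ⟨k, j, b⟩ := c
  cases b
  · exact ⟨k, j + 1, by omega, by omega, by simp [p₁, m, n, sgn]⟩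
  · exact ⟨k + 1, j, by omega, by omega, by simp [p₁, m, n, sgn]⟩

lemma p₂_mem_Delta (c : Cell h) : c.p₂ ∈ Delta h := by
  obtain ⟨k, j, b⟩ := c
  cases b
  · exact ⟨k + 1, j, by omega, by omega, by simp [p₂, m, n, sgn]⟩
  · exact ⟨k, j + 1, by omega, by omega, by simp [p₂, m, n, sgn]⟩

lemma p₀_mem_tri (hh : 1 ≤ h) (c : Cell h) : c.p₀ ∈ c.tri := by
  have h0 : (h : ℝ) ≠ 0 := by exact_mod_cast (by omega : h ≠ 0)
  rw [mem_tri hh]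
  simp [p₀, mul_div_cancel₀ _ h0]

lemma p₁_mem_tri (hh : 1 ≤ h) (c : Cell h) : c.p₁ ∈ c.tri := by
  have h0 : (h : ℝ) ≠ 0 := by exact_mod_cast (by omega : h ≠ 0)
  rw [mem_tri hh]
  simp [p₁, mul_div_cancel₀ _ h0, sgn_mul_self]

lemma p₂_mem_tri (hh : 1 ≤ h) (c : Cell h) : c.p₂ ∈ c.tri := by
  have h0 : (h : ℝ) ≠ 0 := by exact_mod_cast (by omega : h ≠ 0)
  rw [mem_tri hh]
  simp [p₂, mul_div_cancel₀ _ h0, sgn_mul_self]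

lemma tri_subset (hh : 1 ≤ h) (c : Cell h) : c.tri ⊆ OmegaCl := by
  intro x hx
  have h0 : (0 : ℝ) < h := by exact_mod_cast hh
  obtain ⟨k, j, b⟩ := c
  have hk : (k : ℝ) + 1 ≤ h := by exact_mod_cast k.2
  have hj : (j : ℝ) + 1 ≤ h := by exact_mod_cast j.2
  have hk0 : (0 : ℝ) ≤ (k : ℕ) := Nat.cast_nonneg _
  have hj0 : (0 : ℝ) ≤ (j : ℕ) := Nat.cast_nonneg _
  rw [mem_tri hh] at hx
  suffices H : (0 ≤ h * x 0 ∧ h * x 0 ≤ h) ∧ (0 ≤ h * x 1 ∧ h * x 1 ≤ h) by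
    obtain ⟨⟨h1, h2⟩, h3, h4⟩ := H
    exact ⟨⟨nonneg_of_mul_nonneg_right h1 h0, by nlinarith⟩,
      nonneg_of_mul_nonneg_right h3 h0, by nlinarith⟩
  cases b <;> simp only [sgn, m, n, Bool.false_eq_true, if_false, if_true] at hx <;>
    obtain ⟨h1, h2, h3⟩ := hx <;> refine ⟨⟨?_, ?_⟩, ?_, ?_⟩ <;> linarith

lemma exists_fin {h : ℕ} (hh : 1 ≤ h) {y : ℝ} (h0 : 0 ≤ y) (h1 : y ≤ h) :
    ∃ k : Fin h, (k : ℝ) ≤ y ∧ y ≤ k + 1 := by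
  by_cases hy : y = h
  · refine ⟨⟨h - 1, by omega⟩, ?_, ?_⟩ <;> subst hy <;> simp [Nat.cast_sub hh]
  · refine ⟨⟨⌊y⌋₊, (Nat.floor_lt h0).2 (lt_of_le_of_ne h1 hy)⟩, Nat.floor_le h0,
      (Nat.lt_floor_add_one y).le⟩

lemma exists_mem_tri (hh : 1 ≤ h) {x : E2} (hx : x ∈ OmegaCl) : ∃ c : Cell h, x ∈ c.tri := by
  have h0 : (0 : ℝ) < h := by exact_mod_cast hh
  obtain ⟨⟨a1, a2⟩, b1, b2⟩ := hx
  obtain ⟨k, k1, k2⟩ := exists_fin hh (mul_nonneg h0.le a1) (by nlinarith : h * x 0 ≤ h)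
  obtain ⟨j, j1, j2⟩ := exists_fin hh (mul_nonneg h0.le b1) (by nlinarith : h * x 1 ≤ h)
  rcases le_total (h * x 0 + h * x 1) (k + j + 1) with H | H
  · refine ⟨(k, j, true), (mem_tri hh).2 ?_⟩
    simp only [sgn, m, n, if_true]
    refine ⟨?_, ?_, ?_⟩ <;> linarith
  · refine ⟨(k, j, false), (mem_tri hh).2 ?_⟩
    simp only [sgn, m, n, Bool.false_eq_true, if_false]
    refine ⟨?_, ?_, ?_⟩ <;> linarith

lemma isClosed_tri (hh : 1 ≤ h) (c : Cell h) : IsClosed c.tri := by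
  have : c.tri = {x : E2 | 0 ≤ c.sgn * (h * x 0 - c.m)} ∩
      ({x : E2 | 0 ≤ c.sgn * (h * x 1 - c.n)} ∩
      {x : E2 | c.sgn * (h * x 0 - c.m) + c.sgn * (h * x 1 - c.n) ≤ 1}) := by
    ext x
    simp [mem_tri hh]
  rw [this]
  refine (isClosed_le ?_ ?_).inter ((isClosed_le ?_ ?_).inter (isClosed_le ?_ ?_)) <;> fun_prop

lemma convex_tri (hh : 1 ≤ h) (c : Cell h) : Convex ℝ c.tri := by
  intro x hx y hy a b ha hb hab
  rw [mem_tri hh] at *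
  obtain ⟨x1, x2, x3⟩ := hx
  obtain ⟨y1, y2, y3⟩ := hy
  have e (i : Fin 2) (r : ℝ) : c.sgn * (h * (a • x + b • y) i - r) =
      a * (c.sgn * (h * x i - r)) + b * (c.sgn * (h * y i - r)) := by
    simp only [PiLp.add_apply, PiLp.smul_apply, smul_eq_mul]
    linear_combination c.sgn * r * hab
  rw [e, e]
  refine ⟨by positivity, by positivity, ?_⟩
  nlinarith

lemma affine_bary (hh : 1 ≤ h) {c : Cell h} {u : E2 → ℝ} (hu : IsAffineOn u c.tri) {x : E2}
    (hx : x ∈ c.tri) : u x =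
      (1 - c.sgn * (h * x 0 - c.m) - c.sgn * (h * x 1 - c.n)) * u c.p₀ +
      c.sgn * (h * x 0 - c.m) * u c.p₁ + c.sgn * (h * x 1 - c.n) * u c.p₂ := by
  have h0 : (h : ℝ) ≠ 0 := by exact_mod_cast (by omega : h ≠ 0)
  obtain ⟨α, β, γ, H⟩ := isAffineOn_iff.1 hu
  rw [H _ hx, H _ (c.p₀_mem_tri hh), H _ (c.p₁_mem_tri hh), H _ (c.p₂_mem_tri hh)]
  simp only [p₀, p₁, p₂, vtx_zero, vtx_one]
  field_simp
  linear_combination (-(α * (h * x 0 - c.m)) - β * (h * x 1 - c.n)) * c.sgn_mul_self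

lemma norm_grad_sq (hh : 1 ≤ h) {c : Cell h} {u : E2 → ℝ} (hu : IsAffineOn u c.tri) {x : E2}
    (hx : x ∈ interior c.tri) : ‖grad u x‖ ^ 2 =
      h ^ 2 * ((u c.p₁ - u c.p₀) ^ 2 + (u c.p₂ - u c.p₀) ^ 2) := by
  have h0 : (h : ℝ) ≠ 0 := by exact_mod_cast (by omega : h ≠ 0)
  obtain ⟨b, γ, H⟩ := hu
  have hg : HasGradientAt u b x := by
    rw [hasGradientAt_iff_hasFDerivAt]
    have h1 : HasFDerivAt (fun y : E2 => ⟪b, y⟫ + γ) (InnerProductSpace.toDual ℝ E2 b) x :=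
      ((InnerProductSpace.toDual ℝ E2 b).hasFDerivAt (x := x)).add_const γ
    refine h1.congr_of_eventuallyEq ?_
    filter_upwards [mem_interior_iff_mem_nhds.1 hx] with y hy using H y hy
  rw [grad, hg.gradient, H _ (c.p₀_mem_tri hh), H _ (c.p₁_mem_tri hh), H _ (c.p₂_mem_tri hh),
    ← real_inner_self_eq_norm_sq]
  simp only [inner_E2, p₀, p₁, p₂, vtx_zero, vtx_one]
  field_simp
  linear_combination (-(b 0 ^ 2) - b 1 ^ 2) * c.sgn_mul_self

end Cell

lemma MemF.affine {h : ℕ} {u : E2 → ℝ} (hu : MemF h u) (c : Cell h) : IsAffineOn u c.tri := by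
  have := hu.2 (c.1 + 1) (c.2.1 + 1) (by omega) (by omega) (by omega) (by omega)
  unfold Cell.tri
  split_ifs
  exacts [this.1, this.2]

lemma MemF.le_of_le_Delta {h : ℕ} (hh : 1 ≤ h) {p q : E2 → ℝ} (hp : MemF h p) (hq : MemF h q)
    (hle : ∀ x ∈ Delta h, p x ≤ q x) {x : E2} (hx : x ∈ OmegaCl) : p x ≤ q x := by
  obtain ⟨c, hc⟩ := Cell.exists_mem_tri hh hx
  rw [c.affine_bary hh (hp.affine c) hc, c.affine_bary hh (hq.affine c) hc]
  obtain ⟨h1, h2, h3⟩ := (Cell.mem_tri hh).1 hc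
  have h4 : 0 ≤ 1 - c.sgn * (h * x 0 - c.m) - c.sgn * (h * x 1 - c.n) := by linarith
  gcongr
  exacts [hle _ c.p₀_mem_Delta, hle _ c.p₁_mem_Delta, hle _ c.p₂_mem_Delta]

/-! ### The domain -/

lemma isOpen_Omega : IsOpen Omega :=
  (isOpen_Ioo.preimage (continuous_coord 0)).inter (isOpen_Ioo.preimage (continuous_coord 1))

lemma Omega_subset : Omega ⊆ OmegaCl := fun _ hx =>
  ⟨Set.Ioo_subset_Icc_self hx.1, Set.Ioo_subset_Icc_self hx.2⟩

lemma OmegaCl_subset_closure : OmegaCl ⊆ closure Omega := by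
  intro x hx
  let γ : ℝ → E2 := fun t => vtx ((1 - t) * x 0 + t / 2) ((1 - t) * x 1 + t / 2)
  have hγ : Continuous γ := by
    refine (PiLp.continuous_toLp 2 _).comp (continuous_pi fun i => ?_)
    fin_cases i
    · change Continuous fun t : ℝ => (1 - t) * x 0 + t / 2
      fun_prop
    · change Continuous fun t : ℝ => (1 - t) * x 1 + t / 2
      fun_prop
  have h0 : γ 0 = x := by
    ext i
    fin_cases i
    · change (1 - (0 : ℝ)) * x 0 + 0 / 2 = x 0
      ring
    · change (1 - (0 : ℝ)) * x 1 + 0 / 2 = x 1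
      ring
  have hmaps : Set.MapsTo γ (Set.Ioo 0 1) Omega := by
    rintro t ⟨t0, t1⟩
    obtain ⟨⟨a1, a2⟩, b1, b2⟩ := hx
    refine ⟨⟨?_, ?_⟩, ?_, ?_⟩ <;> simp only [γ, vtx_zero, vtx_one] <;> nlinarith
  rw [← h0]
  refine hmaps.closure hγ ?_
  rw [closure_Ioo (by norm_num)]
  simp

lemma Delta_subset {h : ℕ} (hh : 1 ≤ h) : Delta h ⊆ OmegaCl := by
  have h0 : (0 : ℝ) < h := by exact_mod_cast hh
  rintro x ⟨k, j, hk, hj, rfl⟩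
  have hk' : (k : ℝ) ≤ h := by exact_mod_cast hk
  have hj' : (j : ℝ) ≤ h := by exact_mod_cast hj
  refine ⟨⟨?_, ?_⟩, ?_, ?_⟩ <;> simp only [vtx_zero, vtx_one]
  exacts [by positivity, (div_le_one h0).2 hk', by positivity, (div_le_one h0).2 hj']

lemma le_on_OmegaCl {f g : E2 → ℝ} (hf : ContinuousOn f OmegaCl) (hg : ContinuousOn g OmegaCl)
    (hle : ∀ x ∈ Omega, f x ≤ g x) {x : E2} (hx : x ∈ OmegaCl) : f x ≤ g x :=
  ContinuousWithinAt.closure_le (OmegaCl_subset_closure hx) ((hf x hx).mono Omega_subset)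
    ((hg x hx).mono Omega_subset) hle

lemma isCompact_OmegaCl : IsCompact OmegaCl := by
  have h1 : IsCompact (Set.Icc (0 : Fin 2 → ℝ) 1) := isCompact_Icc
  refine (h1.image (PiLp.continuous_toLp 2 _)).of_isClosed_subset ?_ ?_
  · exact (isClosed_Icc.preimage (continuous_coord 0)).inter
      (isClosed_Icc.preimage (continuous_coord 1))
  · intro x hx
    refine ⟨WithLp.ofLp x, ⟨fun i => ?_, fun i => ?_⟩, rfl⟩ <;> fin_cases i
    exacts [hx.1.1, hx.2.1, hx.1.2, hx.2.2]

lemma integrableOn_Omega {f : E2 → ℝ} (hf : ContinuousOn f OmegaCl) : IntegrableOn f Omega :=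
  (hf.integrableOn_compact isCompact_OmegaCl).mono_set Omega_subset

/-! ### Integrals of gradients -/

lemma Cell.ae_mem_interior {h : ℕ} (hh : 1 ≤ h) (c : Cell h) :
    ∀ᵐ x : E2, x ∈ c.tri → x ∈ interior c.tri := by
  have h1 : volume (frontier c.tri) = 0 := (c.convex_tri hh).addHaar_frontier volume
  filter_upwards [compl_mem_ae_iff.2 h1] with x hx hxc
  by_contra hxi
  exact hx ⟨subset_closure hxc, hxi⟩

lemma ae_exists_mem_interior {h : ℕ} (hh : 1 ≤ h) :
    ∀ᵐ x ∂(volume.restrict Omega), ∃ c : Cell h, x ∈ interior c.tri := by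
  filter_upwards [ae_restrict_mem isOpen_Omega.measurableSet,
    ae_restrict_of_ae (ae_all_iff.2 fun c : Cell h => c.ae_mem_interior hh)] with x hx hi
  obtain ⟨c, hc⟩ := Cell.exists_mem_tri hh (Omega_subset hx)
  exact ⟨c, hi c hc⟩

lemma integrableOn_mul_grad {h : ℕ} (hh : 1 ≤ h) {f u : E2 → ℝ} (hf : ContinuousOn f OmegaCl)
    (hu : MemF h u) : IntegrableOn (fun x => f x * ‖grad u x‖ ^ 2) Omega := by
  have H : IntegrableOn (fun x => f x * ‖grad u x‖ ^ 2) (⋃ c : Cell h, c.tri) := by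
    refine integrableOn_finite_iUnion.2 fun c => ?_
    have h1 : IntegrableOn (fun x =>
        f x * (h ^ 2 * ((u c.p₁ - u c.p₀) ^ 2 + (u c.p₂ - u c.p₀) ^ 2))) c.tri :=
      (((hf.mul_const _).integrableOn_compact isCompact_OmegaCl)).mono_set (c.tri_subset hh)
    refine h1.congr ?_
    filter_upwards [ae_restrict_mem (c.isClosed_tri hh).measurableSet,
      ae_restrict_of_ae (c.ae_mem_interior hh)] with x hx hi
    rw [c.norm_grad_sq hh (hu.affine c) (hi hx)]
  refine H.mono_set fun x hx => ?_
  exact Set.mem_iUnion.2 (Cell.exists_mem_tri hh (Omega_subset hx))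

/-! ### Truncation -/

lemma clamp_sub_sq_le (a b : ℝ) :
    (min (max a 0) 1 - min (max b 0) 1) ^ 2 ≤ (a - b) ^ 2 := by
  refine sq_le_sq.2 ((abs_min_sub_min_le_max _ _ _ _).trans ?_)
  simp only [sub_self, abs_zero, max_le_iff, abs_nonneg, and_true]
  simpa using abs_max_sub_max_le_max a 0 b 0

lemma clamp_sq_le (a : ℝ) : (min (max a 0) 1) ^ 2 ≤ a ^ 2 := by
  simpa using clamp_sub_sq_le a 0

lemma one_sub_clamp_sq_le (a : ℝ) : (1 - min (max a 0) 1) ^ 2 ≤ (1 - a) ^ 2 := by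
  simpa using clamp_sub_sq_le 1 a

lemma mem_of_one_sub_sq_le_clamp {a : ℝ} (ha : (1 - a) ^ 2 ≤ (1 - min (max a 0) 1) ^ 2) :
    0 ≤ a ∧ a ≤ 1 := by
  constructor
  · by_contra! h0
    rw [max_eq_right h0.le, min_eq_left zero_le_one] at ha
    nlinarith
  · by_contra! h1
    rw [max_eq_left (by linarith), min_eq_right h1.le] at ha
    nlinarith

/-- The minimizer `v₁` of `J_h(u₁, ·)` over `{v ∈ 𝔽_h : v ≤ v₀ on Ω}`
(with `v₀ ≥ 0` on `Ω`) satisfies `0 ≤ v₁ ≤ 1` on `Ω`. -/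
theorem statement8 (h : ℕ) (hh : 1 ≤ h) (η : ℝ) (hη : 0 < η)
    (u₁ v₀ : E2 → ℝ) (hu₁ : MemF h u₁) (hv₀ : MemF h v₀)
    (hv₀pos : ∀ x ∈ Omega, 0 ≤ v₀ x)
    (v₁ : E2 → ℝ) (hv₁ : MemF h v₁) (hle : ∀ x ∈ Omega, v₁ x ≤ v₀ x)
    (hmin : ∀ v', MemF h v' → (∀ x ∈ Omega, v' x ≤ v₀ x) →
      Jh h η u₁ v₁ ≤ Jh h η u₁ v') :
    ∀ x ∈ Omega, 0 ≤ v₁ x ∧ v₁ x ≤ 1 := by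
  have h_cl_le : ∀ x ∈ OmegaCl, v₁ x ≤ v₀ x := fun x hx => le_on_OmegaCl hv₁.1 hv₀.1 hle hx
  have h_cl_pos : ∀ x ∈ OmegaCl, 0 ≤ v₀ x := fun x hx =>
    le_on_OmegaCl continuousOn_const hv₀.1 hv₀pos hx
  obtain ⟨w, hw, hwv⟩ := exists_interpolates hh fun x => min (max (v₁ x) 0) 1
  have hwle : ∀ x ∈ Omega, w x ≤ v₀ x := fun x hx =>
    hw.le_of_le_Delta hh hv₀ (fun y hy => by
      rw [hwv y hy]
      exact (min_le_left _ _).trans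
        (max_le (h_cl_le y (Delta_subset hh hy)) (h_cl_pos y (Delta_subset hh hy))))
      (Omega_subset hx)
  have hJ := hmin w hw hwle
  have hPw := interpolates_Ph hh fun y => w y ^ 2
  have hPv := interpolates_Ph hh fun y => v₁ y ^ 2
  have hQw := interpolates_Ph hh fun y => (1 - w y) ^ 2
  have hQv := interpolates_Ph hh fun y => (1 - v₁ y) ^ 2
  have hPle : ∀ x ∈ OmegaCl, Ph h (fun y => w y ^ 2) x ≤ Ph h (fun y => v₁ y ^ 2) x :=
    fun x hx => hPw.1.le_of_le_Delta hh hPv.1 (fun y hy => by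
      simp only [hPw.2 y hy, hPv.2 y hy, hwv y hy]
      exact clamp_sq_le _) hx
  have hQle : ∀ x ∈ OmegaCl,
      Ph h (fun y => (1 - w y) ^ 2) x ≤ Ph h (fun y => (1 - v₁ y) ^ 2) x :=
    fun x hx => hQw.1.le_of_le_Delta hh hQv.1 (fun y hy => by
      simp only [hQw.2 y hy, hQv.2 y hy, hwv y hy]
      exact one_sub_clamp_sq_le _) hx
  have h_bulk : ∫ x in Omega, ((Ph h (fun y => w y ^ 2) x + η) * ‖grad u₁ x‖ ^ 2) ≤
      ∫ x in Omega, ((Ph h (fun y => v₁ y ^ 2) x + η) * ‖grad u₁ x‖ ^ 2) := by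
    refine setIntegral_mono_on
      (integrableOn_mul_grad hh (hPw.1.1.add continuousOn_const) hu₁)
      (integrableOn_mul_grad hh (hPv.1.1.add continuousOn_const) hu₁)
      isOpen_Omega.measurableSet fun x hx => ?_
    have := hPle x (Omega_subset hx)
    gcongr
  have h_grad : ∫ x in Omega, ‖grad w x‖ ^ 2 ≤ ∫ x in Omega, ‖grad v₁ x‖ ^ 2 := by
    have hi := integrableOn_mul_grad hh (continuousOn_const (c := (1 : ℝ))) hv₁
    simp only [one_mul] at hi
    refine integral_mono_of_nonneg (Eventually.of_forall fun x => by positivity) hi ?_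
    filter_upwards [ae_exists_mem_interior hh] with x ⟨c, hc⟩
    rw [c.norm_grad_sq hh (hw.affine c) hc, c.norm_grad_sq hh (hv₁.affine c) hc,
      hwv _ c.p₀_mem_Delta, hwv _ c.p₁_mem_Delta, hwv _ c.p₂_mem_Delta]
    exact mul_le_mul_of_nonneg_left
      (add_le_add (clamp_sub_sq_le _ _) (clamp_sub_sq_le _ _)) (sq_nonneg _)
  have hQint : ∫ x in Omega, Ph h (fun y => (1 - v₁ y) ^ 2) x ≤
      ∫ x in Omega, Ph h (fun y => (1 - w y) ^ 2) x := by
    simp only [Jh] at hJ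
    linarith
  have h_zero : ∫ x in Omega, (Ph h (fun y => (1 - v₁ y) ^ 2) x -
      Ph h (fun y => (1 - w y) ^ 2) x) = 0 := by
    refine le_antisymm ?_ (setIntegral_nonneg isOpen_Omega.measurableSet fun x hx =>
      sub_nonneg.2 (hQle x (Omega_subset hx)))
    rw [integral_sub (integrableOn_Omega hQv.1.1) (integrableOn_Omega hQw.1.1)]
    linarith
  have h_ae := (setIntegral_eq_zero_iff_of_nonneg_ae
    ((ae_restrict_mem isOpen_Omega.measurableSet).mono fun x hx =>
      sub_nonneg.2 (hQle x (Omega_subset hx)))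
    (integrableOn_Omega (hQv.1.1.sub hQw.1.1))).1 h_zero
  have h_eq := Measure.eqOn_open_of_ae_eq h_ae isOpen_Omega
    ((hQv.1.1.sub hQw.1.1).mono Omega_subset) continuousOn_const
  have h_vert : ∀ x ∈ Delta h, 0 ≤ v₁ x ∧ v₁ x ≤ 1 := fun x hx => by
    have := le_on_OmegaCl hQv.1.1 hQw.1.1 (fun y hy => (sub_eq_zero.1 (h_eq hy)).le)
      (Delta_subset hh hx)
    simp only [hQv.2 x hx, hQw.2 x hx, hwv x hx] at this
    exact mem_of_one_sub_sq_le_clamp this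
  exact fun x hx =>
    ⟨(memF_const h 0).le_of_le_Delta hh hv₁ (fun y hy => (h_vert y hy).1) (Omega_subset hx),
      hv₁.le_of_le_Delta hh (memF_const h 1) (fun y hy => (h_vert y hy).2) (Omega_subset hx)⟩
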